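/- arXiv:cs/0210025 — 3 statements merged into one kernel-verified Lean document; each statement's English description precedes it below -/
import Mathlib

section
/- Let A be a finite alphabet, μ a probability measure on A^ℕ with the product σ-algebra, S a set, and η : A* → S a function assigning a state to every finite word. Assume: (weak prescience) for all words w, w' with μ(C(w)) > 0, μ(C(w')) > 0 and η(w) = η(w'), and every symbol a ∈ A, P(a|w) = P(a|w'); and (determinism) for all such w, w' with η(w) = η(w') and every a ∈ A with μ(C(wa)) > 0 and μ(C(w'a)) > 0, η(wa) = η(w'a). Then η is prescient: for all words w, w' with μ(C(w)) > 0, μ(C(w')) > 0 and η(w) = η(w'), and every finite word v, P(v|w) = P(v|w'). -/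
open MeasureTheory

/-- The cylinder set of a finite word `w`: all sequences beginning with `w`. -/
def cyl {A : Type*} (w : List A) : Set (ℕ → A) :=
  {ω | ∀ i : Fin w.length, ω i = w.get i}

/-- Conditional probability `P(v | w) = μ(C(wv)) / μ(C(w))` of seeing the future word `v`
after the history `w`. -/
noncomputable def condP {A : Type*} [MeasurableSpace A]
    (μ : Measure (ℕ → A)) (w v : List A) : ENNReal :=
  μ (cyl (w ++ v)) / μ (cyl w)

theorem cyl_append_subset {A : Type*} (w v : List A) : cyl (w ++ v) ⊆ cyl w := by
  intro ω hω i
  have hi : (i : ℕ) < (w ++ v).length := by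
    rw [List.length_append]
    exact i.2.trans_le (Nat.le_add_right _ _)
  simpa [List.getElem_append_left i.2] using hω ⟨i, hi⟩

/-- Chain rule for conditional probabilities of future words. -/
theorem condP_append {A : Type*} [MeasurableSpace A] (μ : Measure (ℕ → A))
    [IsFiniteMeasure μ] (w u v : List A) :
    condP μ w (u ++ v) = condP μ w u * condP μ (w ++ u) v := by
  unfold condP
  rw [← List.append_assoc]
  by_cases h : μ (cyl (w ++ u)) = 0
  · rw [measure_mono_null (cyl_append_subset (w ++ u) v) h, h]
    simp
  · rw [mul_comm, ← mul_div_assoc, ENNReal.div_mul_cancel h (measure_ne_top _ _)]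

theorem condP_ne_zero_iff {A : Type*} [MeasurableSpace A] (μ : Measure (ℕ → A))
    [IsFiniteMeasure μ] (w v : List A) :
    condP μ w v ≠ 0 ↔ 0 < μ (cyl (w ++ v)) := by
  simp [condP, ENNReal.div_eq_zero_iff, pos_iff_ne_zero]

/-- A weakly prescient and deterministic set of states is prescient: if the state map `η`
determines the next-symbol distribution and is deterministically updated, then histories
with equal states agree on the conditional probability of every finite future word. -/
theorem weakly_prescient_deterministic_implies_prescient
    {A : Type*} [Fintype A] [MeasurableSpace A] [MeasurableSingletonClass A]
    (μ : Measure (ℕ → A)) [IsProbabilityMeasure μ]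
    {S : Type*} (η : List A → S)
    (hweak : ∀ w w' : List A, 0 < μ (cyl w) → 0 < μ (cyl w') → η w = η w' →
      ∀ a : A, condP μ w [a] = condP μ w' [a])
    (hdet : ∀ w w' : List A, 0 < μ (cyl w) → 0 < μ (cyl w') → η w = η w' →
      ∀ a : A, 0 < μ (cyl (w ++ [a])) → 0 < μ (cyl (w' ++ [a])) →
        η (w ++ [a]) = η (w' ++ [a])) :
    ∀ w w' : List A, 0 < μ (cyl w) → 0 < μ (cyl w') → η w = η w' →
      ∀ v : List A, condP μ w v = condP μ w' v := by
  intro w w' hw hw' hη v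
  induction v generalizing w w' with
  | nil =>
    simp [condP, ENNReal.div_self hw.ne' (measure_ne_top _ _),
      ENNReal.div_self hw'.ne' (measure_ne_top _ _)]
  | cons a v ih =>
    have ha := hweak w w' hw hw' hη a
    rw [← List.singleton_append, condP_append, condP_append, ← ha]
    by_cases h : condP μ w [a] = 0
    · simp [h]
    · have hwa := (condP_ne_zero_iff μ w [a]).1 h
      have hwa' := (condP_ne_zero_iff μ w' [a]).1 (ha ▸ h)
      rw [ih _ _ hwa hwa' (hdet w w' hw hw' hη a hwa hwa')]
end

section
/- Let A be a finite alphabet, μ a probability measure on A^ℕ with the product σ-algebra, L ≥ 1, S a set, and η : A^L → S a prescient partition of the length-L words, i.e., for every length-L word w with μ(C(w)) > 0 and every finite word v, μ( ⋃_{w'∈η⁻¹(η(w)), μ(C(w'))>0} C(w'v) ) / μ( ⋃_{w'∈η⁻¹(η(w)), μ(C(w'))>0} C(w') ) = P(v|w). For each causal state c (equivalence class of ≈ among positive-probability length-L words) let q_c = μ(⋃_{w∈c} C(w)), and for each s ∈ S let r_s = μ(⋃_{w∈η⁻¹(s), μ(C(w))>0} C(w)). Then Σ_c −q_c·log q_c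 ≤ Σ_s −r_s·log r_s; that is, the Shannon entropy of the causal-state partition (the statistical complexity) is at most the Shannon entropy of any prescient partition. -/
open MeasureTheory

open Classical in
/-- The causal state (equivalence class under causal equivalence) of a length-`L` word
`w`, as a finset of length-`L` words of positive probability. -/
noncomputable def causalClass {A : Type*} [Fintype A] [MeasurableSpace A]
    (μ : Measure (ℕ → A)) (L : ℕ) (w : Fin L → A) : Finset (Fin L → A) :=
  Finset.univ.filter fun u => 0 < μ (cyl (List.ofFn u)) ∧
    ∀ v : List A, condP μ (List.ofFn w) v = condP μ (List.ofFn u) v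

open Classical in
/-- The set of causal states at length `L`: the equivalence classes of causal equivalence
among the positive-probability length-`L` words. -/
noncomputable def causalCells {A : Type*} [Fintype A] [MeasurableSpace A]
    (μ : Measure (ℕ → A)) (L : ℕ) : Finset (Finset (Fin L → A)) :=
  (Finset.univ.filter fun u : Fin L → A => 0 < μ (cyl (List.ofFn u))).image
    (causalClass μ L)

/-- The statistical complexity: the Shannon entropy of the causal-state partition at
length `L` (with the convention `0 log 0 = 0`). -/
noncomputable def statComplexity {A : Type*} [Fintype A] [MeasurableSpace A]
    (μ : Measure (ℕ → A)) (L : ℕ) : ℝ :=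
  ∑ c ∈ causalCells μ L,
    Real.negMulLog (μ (⋃ w ∈ (c : Finset (Fin L → A)), cyl (List.ofFn w))).toReal


lemma sum_negMulLog_fiber_eq {W T : Type*} [DecidableEq T] (P : Finset W) (p : W → ℝ)
    (f : W → T) :
    ∑ c ∈ P.image f, Real.negMulLog (∑ u ∈ P with f u = c, p u) =
      ∑ u ∈ P, p u * -Real.log (∑ v ∈ P with f v = f u, p v) := by
  refine Finset.sum_image' _ fun w _ => ?_
  rw [Real.negMulLog, neg_mul_comm, Finset.sum_mul]
  refine Finset.sum_congr rfl fun u hu => ?_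
  rw [(Finset.mem_filter.1 hu).2]

/-- The entropy of a partition of a finite weighted set does not exceed that of a refinement. -/
lemma sum_negMulLog_fiber_le_of_refines {W T S : Type*} [DecidableEq T] [DecidableEq S]
    (P : Finset W) (p : W → ℝ) (hp : ∀ u, 0 ≤ p u) (f : W → T) (g : W → S)
    (hfg : ∀ u ∈ P, ∀ w ∈ P, g u = g w → f u = f w) :
    ∑ c ∈ P.image f, Real.negMulLog (∑ u ∈ P with f u = c, p u) ≤
      ∑ s ∈ P.image g, Real.negMulLog (∑ u ∈ P with g u = s, p u) := by
  rw [sum_negMulLog_fiber_eq, sum_negMulLog_fiber_eq]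
  refine Finset.sum_le_sum fun u hu => ?_
  rcases (hp u).eq_or_lt with h0 | hpos
  · simp [← h0]
  refine mul_le_mul_of_nonneg_left (neg_le_neg (Real.log_le_log ?_ ?_)) hpos.le
  · exact hpos.trans_le
      (Finset.single_le_sum (f := p) (fun v _ => hp v) (Finset.mem_filter.2 ⟨hu, rfl⟩))
  · refine Finset.sum_le_sum_of_subset_of_nonneg (fun v hv => ?_) fun v _ _ => hp v
    obtain ⟨hvP, hv⟩ := Finset.mem_filter.1 hv
    exact Finset.mem_filter.2 ⟨hvP, hfg v hvP u hu hv⟩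

lemma mem_cyl_ofFn {A : Type*} {L : ℕ} {w : Fin L → A} {ω : ℕ → A} :
    ω ∈ cyl (List.ofFn w) ↔ ∀ i : Fin L, ω i = w i := by
  constructor
  · intro h i
    simpa using h ⟨i, by simp⟩
  · intro h i
    simpa using h ⟨i, by simpa using i.2⟩

lemma measurableSet_cyl {A : Type*} [MeasurableSpace A] [MeasurableSingletonClass A]
    (w : List A) : MeasurableSet (cyl w) := by
  rw [cyl, Set.ofPred_forall]
  exact MeasurableSet.iInter fun i =>
    (measurableSet_singleton (w.get i)).preimage (measurable_pi_apply (i : ℕ))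

lemma disjoint_cyl_ofFn {A : Type*} {L : ℕ} {u w : Fin L → A} (h : u ≠ w) :
    Disjoint (cyl (List.ofFn u)) (cyl (List.ofFn w)) :=
  Set.disjoint_left.2 fun _ hu hw =>
    h (funext fun i => (mem_cyl_ofFn.1 hu i).symm.trans (mem_cyl_ofFn.1 hw i))

lemma toReal_measure_biUnion_cyl {A : Type*} [MeasurableSpace A] [MeasurableSingletonClass A]
    (μ : Measure (ℕ → A)) [IsProbabilityMeasure μ] {L : ℕ} (s : Finset (Fin L → A)) :
    (μ (⋃ w ∈ s, cyl (List.ofFn w))).toReal = ∑ w ∈ s, (μ (cyl (List.ofFn w))).toReal := by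
  rw [measure_biUnion_finset (fun u _ w _ h => disjoint_cyl_ofFn h)
    (fun w _ => measurableSet_cyl _), ENNReal.toReal_sum fun w _ => measure_ne_top _ _]

lemma causalClass_eq_iff {A : Type*} [Fintype A] [MeasurableSpace A]
    (μ : Measure (ℕ → A)) {L : ℕ} {u w : Fin L → A} (hu : 0 < μ (cyl (List.ofFn u))) :
    causalClass μ L u = causalClass μ L w ↔
      ∀ v, condP μ (List.ofFn w) v = condP μ (List.ofFn u) v := by
  classical
  constructor
  · intro h
    have hmem : u ∈ causalClass μ L u := by simp [causalClass, hu]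
    rw [h, causalClass, Finset.mem_filter] at hmem
    exact hmem.2.2
  · intro h
    ext x
    simp [causalClass, h]

/-- The statistical complexity is minimal among prescient partitions: the Shannon entropy
of the causal-state partition at length `L` is at most the Shannon entropy of any
prescient partition `η` of the length-`L` histories. -/
theorem statComplexity_le_prescient_entropy
    {A : Type*} [Fintype A] [MeasurableSpace A] [MeasurableSingletonClass A]
    (μ : Measure (ℕ → A)) [IsProbabilityMeasure μ]
    (L : ℕ) (hL : 1 ≤ L) {S : Type*} [DecidableEq S] (η : (Fin L → A) → S)
    (hpres : ∀ w : Fin L → A, 0 < μ (cyl (List.ofFn w)) → ∀ v : List A,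
      μ (⋃ w' ∈ {u : Fin L → A | η u = η w ∧ 0 < μ (cyl (List.ofFn u))},
          cyl (List.ofFn w' ++ v)) /
        μ (⋃ w' ∈ {u : Fin L → A | η u = η w ∧ 0 < μ (cyl (List.ofFn u))},
          cyl (List.ofFn w'))
        = condP μ (List.ofFn w) v) :
    statComplexity μ L ≤
      ∑ s ∈ Finset.univ.image η,
        Real.negMulLog
          (μ (⋃ w ∈ {u : Fin L → A | η u = s ∧ 0 < μ (cyl (List.ofFn u))},
            cyl (List.ofFn w))).toReal := by
  classical
  set P : Finset (Fin L → A) := Finset.univ.filter fun u => 0 < μ (cyl (List.ofFn u)) with hP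
  have memP : ∀ {u}, u ∈ P ↔ 0 < μ (cyl (List.ofFn u)) := by simp [hP]
  set p : (Fin L → A) → ℝ := fun u => (μ (cyl (List.ofFn u))).toReal
  have hr : ∀ s, (μ (⋃ w ∈ {u : Fin L → A | η u = s ∧ 0 < μ (cyl (List.ofFn u))},
      cyl (List.ofFn w))).toReal = ∑ u ∈ P with η u = s, p u := by
    intro s
    rw [← toReal_measure_biUnion_cyl]
    simp [hP, and_comm]
  have hq : statComplexity μ L = ∑ c ∈ P.image (causalClass μ L),
      Real.negMulLog (∑ u ∈ P with causalClass μ L u = c, p u) := by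
    have hcells : causalCells μ L = P.image (causalClass μ L) := by
      simp only [causalCells, hP]
    rw [statComplexity, hcells]
    refine Finset.sum_congr rfl fun c hc => ?_
    obtain ⟨w, -, rfl⟩ := Finset.mem_image.1 hc
    rw [toReal_measure_biUnion_cyl]
    refine congrArg _ (Finset.sum_congr ?_ fun _ _ => rfl)
    ext u
    rw [Finset.mem_filter, causalClass, Finset.mem_filter, memP]
    simp only [Finset.mem_univ, true_and]
    exact and_congr_right fun hu => (causalClass_eq_iff μ hu).symm
  simp only [hr]
  rw [hq]
  refine (sum_negMulLog_fiber_le_of_refines P p (fun _ => ENNReal.toReal_nonneg)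
    (causalClass μ L) η fun u hu w hw huw => ?_).trans_eq ?_
  · refine (causalClass_eq_iff μ (memP.1 hu)).2 fun v => ?_
    rw [← hpres w (memP.1 hw) v, ← hpres u (memP.1 hu) v, huw]
  · refine Finset.sum_subset (Finset.image_subset_image (Finset.subset_univ P)) fun s _ hs => ?_
    rw [Finset.filter_eq_empty_iff.2 fun u hu h => hs (Finset.mem_image.2 ⟨u, hu, h⟩)]
    simp
end

section
/- Let A be a finite alphabet, μ a probability measure on A^ℕ with the product σ-algebra, and L ≥ 1. Let X : A^ℕ → A^L be the map ω ↦ (ω_0, …, ω_{L−1}) giving the length-L history, let Y : A^ℕ → A be the next observable Y(ω) = ω_L, and let ε : A^L → Σ be any map that sends each length-L word of positive μ-probability to its causal state (its ≈-equivalence class among length-L positive-probability words). Then the conditional Shannon entropy of the next observable given the causal state equals that given the full length-L history: H[Y | ε∘X] = H[Y | X] (both computed with respect to μ). -/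
open MeasureTheory

/-- The length-`L` history of a sequence: its first `L` symbols. -/
def histL {A : Type*} (L : ℕ) (ω : ℕ → A) : Fin L → A := fun i => ω i.1

/-- Chain rule for a finite joint mass function `q` with marginal `p`. -/
lemma sum_negMulLog_joint_sub_marginal {α β : Type*} [Fintype α] (t : Finset β)
    (q : α → β → ℝ) (p : β → ℝ) (hqp : ∀ w ∈ t, ∑ a, q a w = p w) :
    (∑ a, ∑ w ∈ t, Real.negMulLog (q a w)) - ∑ w ∈ t, Real.negMulLog (p w)
      = ∑ a, ∑ w ∈ t, q a w * (Real.log (p w) - Real.log (q a w)) := by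
  have h : ∑ w ∈ t, Real.negMulLog (p w) = ∑ a, ∑ w ∈ t, -(q a w * Real.log (p w)) := by
    rw [Finset.sum_comm]
    refine Finset.sum_congr rfl fun w hw => ?_
    rw [Finset.sum_neg_distrib, ← Finset.sum_mul, hqp w hw, Real.negMulLog, neg_mul]
  rw [h, ← Finset.sum_sub_distrib]
  refine Finset.sum_congr rfl fun a _ => ?_
  rw [← Finset.sum_sub_distrib]
  refine Finset.sum_congr rfl fun w _ => ?_
  rw [Real.negMulLog]
  ring

/-- Coarse-graining the conditioning variable along `ε` preserves conditional entropy when the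
conditional laws agree on the fibres of `ε`. -/
lemma condEntropy_coarse_eq_of_proportional {α β S : Type*} [Fintype α] [Fintype β]
    [DecidableEq S] (ε : β → S) (q : α → β → ℝ) (p : β → ℝ)
    (hq : ∀ a w, 0 ≤ q a w) (hqp : ∀ w, ∑ a, q a w = p w)
    (hprop : ∀ a w w', ε w = ε w' → q a w * p w' = q a w' * p w) :
    (∑ a, ∑ s ∈ Finset.univ.image ε, Real.negMulLog (∑ w with ε w = s, q a w))
        - ∑ s ∈ Finset.univ.image ε, Real.negMulLog (∑ w with ε w = s, p w)
      = (∑ a, ∑ w, Real.negMulLog (q a w)) - ∑ w, Real.negMulLog (p w) := by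
  rw [sum_negMulLog_joint_sub_marginal _ (fun a s => ∑ w with ε w = s, q a w)
      (fun s => ∑ w with ε w = s, p w)
      (fun s _ => by rw [Finset.sum_comm]; exact Finset.sum_congr rfl fun w _ => hqp w),
    sum_negMulLog_joint_sub_marginal _ q p fun w _ => hqp w]
  refine Finset.sum_congr rfl fun a _ => ?_
  rw [← Finset.sum_fiberwise_of_maps_to (s := Finset.univ) (t := Finset.univ.image ε) (g := ε)
    (fun w _ => Finset.mem_image_of_mem ε (Finset.mem_univ w))]
  refine Finset.sum_congr rfl fun s _ => ?_
  rw [Finset.sum_mul]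
  refine Finset.sum_congr rfl fun w hw => ?_
  have hws : ε w = s := (Finset.mem_filter.mp hw).2
  rcases (hq a w).eq_or_lt with h0 | h0
  · simp [← h0]
  have hqle : ∀ w, q a w ≤ p w := fun w => by
    rw [← hqp w]
    exact Finset.single_le_sum (fun a _ => hq a w) (Finset.mem_univ a)
  have hQ : 0 < ∑ w with ε w = s, q a w :=
    h0.trans_le (Finset.single_le_sum (fun w _ => hq a w) hw)
  have hP : 0 < ∑ w with ε w = s, p w :=
    hQ.trans_le (Finset.sum_le_sum fun w _ => hqle w)
  have hmul : q a w * (∑ w with ε w = s, p w) = (∑ w with ε w = s, q a w) * p w := by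
    rw [Finset.mul_sum, Finset.sum_mul]
    exact Finset.sum_congr rfl fun w' hw' =>
      hprop a w w' (hws.trans (Finset.mem_filter.mp hw').2.symm)
  have hlog := congrArg Real.log hmul
  rw [Real.log_mul h0.ne' hP.ne', Real.log_mul hQ.ne' (h0.trans_le (hqle w)).ne'] at hlog
  congr 1
  linarith

lemma cyl_ofFn {A : Type*} {L : ℕ} (w : Fin L → A) :
    cyl (List.ofFn w) = {ω | histL L ω = w} := by
  ext ω
  simp only [cyl, Set.mem_ofPred_eq, funext_iff, histL, List.get_eq_getElem, List.getElem_ofFn]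
  exact ⟨fun h i => h ⟨i, by simp⟩, fun h i => h ⟨i, by simpa using i.2⟩⟩

lemma cyl_ofFn_append_singleton {A : Type*} {L : ℕ} (w : Fin L → A) (a : A) :
    cyl (List.ofFn w ++ [a]) = {ω | ω L = a ∧ histL L ω = w} := by
  ext ω
  simp only [cyl, Set.mem_ofPred_eq, funext_iff, histL, List.get_eq_getElem]
  constructor
  · intro h
    refine ⟨by simpa using h ⟨L, by simp⟩, fun i => ?_⟩
    have := h ⟨i, by simp⟩
    simpa [List.getElem_append] using this
  · rintro ⟨ha, hw⟩ ⟨i, hi⟩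
    rw [List.length_append, List.length_ofFn, List.length_singleton] at hi
    rcases Nat.lt_succ_iff_lt_or_eq.mp hi with h | rfl
    · simpa [List.getElem_append, h] using hw ⟨i, h⟩
    · simpa using ha

lemma measurable_histL {A : Type*} [MeasurableSpace A] (L : ℕ) :
    Measurable (histL (A := A) L) :=
  measurable_pi_lambda _ fun i => measurable_pi_apply i.1

/-- The causal states are weakly prescient: the conditional Shannon entropy of the next
observable `Y(ω) = ω_L` given the causal state `ε∘X` of the length-`L` history
`X(ω) = (ω_0, …, ω_{L-1})` equals the conditional Shannon entropy of `Y` given the full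
history `X` (conditional entropies written as `H[U,V] - H[V]`, with `0 log 0 = 0`). -/
theorem condEntropy_next_given_causal_state_eq_given_history
    {A : Type*} [Fintype A] [MeasurableSpace A] [MeasurableSingletonClass A]
    (μ : Measure (ℕ → A)) [IsProbabilityMeasure μ]
    (L : ℕ) (hL : 1 ≤ L)
    {S : Type*} [DecidableEq S] (ε : (Fin L → A) → S)
    (hε : ∀ w w' : Fin L → A,
      0 < μ (cyl (List.ofFn w)) → 0 < μ (cyl (List.ofFn w')) →
      (ε w = ε w' ↔
        ∀ v : List A, condP μ (List.ofFn w) v = condP μ (List.ofFn w') v)) :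
    (∑ a : A, ∑ s ∈ Finset.univ.image ε,
        Real.negMulLog (μ {ω | ω L = a ∧ ε (histL L ω) = s}).toReal)
      - (∑ s ∈ Finset.univ.image ε,
          Real.negMulLog (μ {ω | ε (histL L ω) = s}).toReal)
    = (∑ a : A, ∑ w : Fin L → A,
        Real.negMulLog (μ {ω | ω L = a ∧ histL L ω = w}).toReal)
      - ∑ w : Fin L → A,
          Real.negMulLog (μ {ω | histL L ω = w}).toReal := by
  have hsing : ∀ w : Fin L → A, MeasurableSet (histL L ⁻¹' {w}) := fun w =>
    measurable_histL L (measurableSet_singleton w)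
  have hnext : ∀ a : A, MeasurableSet ((fun ω : ℕ → A => ω L) ⁻¹' {a}) := fun a =>
    measurable_pi_apply L (measurableSet_singleton a)
  have hmarg : ∀ w : Fin L → A, ∑ a : A, μ.real {ω | ω L = a ∧ histL L ω = w}
      = μ.real {ω | histL L ω = w} := fun w => by
    have h := sum_measureReal_preimage_singleton (μ := μ.restrict (histL L ⁻¹' {w}))
      (Finset.univ : Finset A) (fun a _ => hnext a)
    simp only [measureReal_restrict_apply (hnext _), Finset.coe_univ, Set.preimage_univ,
      measureReal_restrict_apply_univ] at h
    exact h
  have hP : ∀ s, μ.real {ω | ε (histL L ω) = s}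
      = ∑ w with ε w = s, μ.real {ω | histL L ω = w} := fun s => by
    have h := sum_measureReal_preimage_singleton (μ := μ)
      (Finset.univ.filter fun w => ε w = s) (fun w _ => hsing w)
    simpa [Set.preimage] using h.symm
  have hQ : ∀ a s, μ.real {ω | ω L = a ∧ ε (histL L ω) = s}
      = ∑ w with ε w = s, μ.real {ω | ω L = a ∧ histL L ω = w} := fun a s => by
    have h := sum_measureReal_preimage_singleton
      (μ := μ.restrict ((fun ω : ℕ → A => ω L) ⁻¹' {a}))
      (Finset.univ.filter fun w => ε w = s) (fun w _ => hsing w)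
    simp only [measureReal_restrict_apply' (hnext a), Set.inter_comm _ (_ ⁻¹' {a})] at h
    simpa [Set.preimage, ← Set.ofPred_and] using h.symm
  have hprop : ∀ (a : A) (w w' : Fin L → A), ε w = ε w' →
      μ.real {ω | ω L = a ∧ histL L ω = w} * μ.real {ω | histL L ω = w'}
        = μ.real {ω | ω L = a ∧ histL L ω = w'} * μ.real {ω | histL L ω = w} := by
    intro a w w' hww'
    have hnull : ∀ u : Fin L → A, μ.real {ω | histL L ω = u} = 0 →
        μ.real {ω | ω L = a ∧ histL L ω = u} = 0 := fun u hu =>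
      le_antisymm (hu ▸ measureReal_mono fun ω h => h.2) measureReal_nonneg
    by_cases h : μ.real {ω | histL L ω = w} = 0
    · rw [h, hnull w h, zero_mul, mul_zero]
    by_cases h' : μ.real {ω | histL L ω = w'} = 0
    · rw [h', hnull w' h', zero_mul, mul_zero]
    have hpos : ∀ u : Fin L → A, μ.real {ω | histL L ω = u} ≠ 0 →
        0 < μ (cyl (List.ofFn u)) := fun u hu => by
      rw [cyl_ofFn, pos_iff_ne_zero]
      exact fun h0 => hu (by rw [measureReal_def, h0, ENNReal.toReal_zero])
    have hcond := congrArg ENNReal.toReal ((hε w w' (hpos w h) (hpos w' h')).mp hww' [a])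
    simp only [condP, cyl_ofFn_append_singleton, cyl_ofFn, ENNReal.toReal_div,
      ← measureReal_def] at hcond
    rwa [div_eq_div_iff h h'] at hcond
  simp only [← measureReal_def, hP, hQ]
  exact condEntropy_coarse_eq_of_proportional ε _ _ (fun _ _ => measureReal_nonneg) hmarg hprop
end
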